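/- arXiv:math/0512589 — 3 statements merged into one kernel-verified Lean document; each statement's English description precedes it below -/
import Mathlib

section
/- Every square matrix over a field F is similar over F to a block diagonal matrix diag(A₁,…,A_p), where each A_i is a d_i k_i × d_i k_i block matrix with k_i copies of the companion matrix C_i of a monic irreducible polynomial g_i ∈ F[x] of degree d_i on the diagonal and, directly below each diagonal block, the d_i × d_i matrix B_i having a single 1 in its top-right corner and zeros elsewhere. -/
/-- The companion matrix of a monic polynomial `g = x^d - a₁x^{d-1} - ⋯ - a_d`:
ones on the first subdiagonal, last column `(a_d, …, a₁)ᵀ`, zeros elsewhere. -/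
def companionMatrix {F : Type*} [Field F] (g : Polynomial F) :
    Matrix (Fin g.natDegree) (Fin g.natDegree) F := fun i j =>
  if (i : ℕ) = (j : ℕ) + 1 then 1
  else if (j : ℕ) = g.natDegree - 1 then -(g.coeff i)
  else 0

/-- The generalized Jordan block built from `k` copies of the companion matrix of `g`
on the diagonal, with the matrix having a single `1` in its top-right corner
directly below each diagonal block. -/
def genJordanBlock {F : Type*} [Field F] (g : Polynomial F) (k : ℕ) :
    Matrix (Fin k × Fin g.natDegree) (Fin k × Fin g.natDegree) F := fun p q =>
  if p.1 = q.1 then companionMatrix g p.2 q.2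
  else if (p.1 : ℕ) = (q.1 : ℕ) + 1 then
    (if (p.2 : ℕ) = 0 ∧ (q.2 : ℕ) = g.natDegree - 1 then 1 else 0)
  else 0


open Polynomial

theorem gj_block_action {F : Type*} [Field F] {N : Type*} [AddCommGroup N] [Module F N]
    [Module F[X] N] [IsScalarTower F F[X] N] (g : F[X]) (hg : g.Monic) (k : ℕ) (z : N)
    (hz : g ^ k • z = 0) (q : Fin k × Fin g.natDegree) :
    (X : F[X]) • ((X ^ (q.2 : ℕ) * g ^ (q.1 : ℕ)) • z) =
      ∑ p, genJordanBlock g k p q • ((X ^ (p.2 : ℕ) * g ^ (p.1 : ℕ)) • z) := by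
  obtain ⟨a, b⟩ := q
  rw [Fintype.sum_prod_type]
  dsimp only
  by_cases hb : (b : ℕ) = g.natDegree - 1
  · have hd : 0 < g.natDegree := b.pos
    -- decompose `X ^ d`
    have hX : (X : F[X]) * X ^ (b : ℕ) =
        g + ∑ i : Fin g.natDegree, C (-(g.coeff i)) * X ^ (i : ℕ) := by
      have h1 := hg.as_sum
      rw [Finset.sum_range] at h1
      rw [← pow_succ', hb, Nat.sub_add_cancel hd]
      simp only [C_neg, neg_mul, Finset.sum_neg_distrib]
      exact eq_add_neg_of_add_eq h1.symm
    have hsame : ∑ y, genJordanBlock g k (a, y) (a, b) • ((X ^ (y : ℕ) * g ^ (a : ℕ)) • z) =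
        ((∑ i : Fin g.natDegree, C (-(g.coeff i)) * X ^ (i : ℕ)) * g ^ (a : ℕ)) • z := by
      rw [Finset.sum_mul, Finset.sum_smul]
      refine Finset.sum_congr rfl fun y _ => ?_
      have : genJordanBlock g k (a, y) (a, b) = -(g.coeff y) := by
        have := y.2
        simp only [genJordanBlock, companionMatrix, if_true]
        rw [if_neg (by omega), if_pos hb]
      rw [this, mul_assoc, ← smul_eq_C_mul, smul_assoc]
    have hoff : ∀ x : Fin k, x ≠ a →
        ∑ y, genJordanBlock g k (x, y) (a, b) • ((X ^ (y : ℕ) * g ^ (x : ℕ)) • z) =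
        if (x : ℕ) = a + 1 then g ^ (x : ℕ) • z else 0 := by
      intro x hx
      rw [Finset.sum_eq_single (⟨0, hd⟩ : Fin g.natDegree)]
      · simp [genJordanBlock, hx, hb]
      · intro y _ hy
        have : (y : ℕ) ≠ 0 := fun h => hy (Fin.ext h)
        simp [genJordanBlock, hx, this]
      · simp
    rw [← Finset.add_sum_erase _ _ (Finset.mem_univ a), hsame,
      Finset.sum_congr rfl (fun x hx => hoff x (Finset.ne_of_mem_erase hx)),
      smul_smul, ← mul_assoc, hX, add_mul, add_smul, add_comm]
    congr 1
    rw [← pow_succ']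
    by_cases ha : (a : ℕ) + 1 < k
    · rw [Finset.sum_eq_single (⟨a + 1, ha⟩ : Fin k)]
      · simp
      · intro x _ hx
        rw [if_neg (fun h => hx (Fin.ext h))]
      · intro h
        exact absurd (Finset.mem_erase.2 ⟨by simp [Fin.ext_iff], Finset.mem_univ _⟩) h
    · have : (a : ℕ) + 1 = k := by omega
      rw [this, hz, Finset.sum_eq_zero]
      intro x _
      rw [if_neg (by omega)]
  · have hb' : (b : ℕ) + 1 < g.natDegree := by omega
    rw [Finset.sum_eq_single a, Finset.sum_eq_single (⟨b + 1, hb'⟩ : Fin g.natDegree)]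
    · simp [genJordanBlock, companionMatrix, smul_smul, pow_succ', mul_assoc]
    · intro y _ hy
      have : (y : ℕ) ≠ b + 1 := fun h => hy (Fin.ext h)
      simp [genJordanBlock, companionMatrix, hb, this]
    · simp
    · intro x _ hx
      refine Finset.sum_eq_zero fun y _ => ?_
      simp [genJordanBlock, hb, hx]
    · simp

theorem gj_block_basis {F : Type*} [Field F] (g : F[X]) (hg : g.Monic) (hi : Irreducible g)
    (k : ℕ) (I : Ideal F[X]) (hI : I = Ideal.span {g ^ k}) :
    ∃ b : Module.Basis (Fin k × Fin g.natDegree) F (F[X] ⧸ I),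
      ∀ q, (X : F[X]) • b q = ∑ p, genJordanBlock g k p q • b p := by
  subst hI
  set N := F[X] ⧸ Ideal.span {g ^ k}
  let z : N := Ideal.Quotient.mk _ 1
  have hsm : ∀ h : F[X], h • z = Ideal.Quotient.mk _ h := by
    intro h
    change Ideal.Quotient.mk _ (h * 1) = _
    rw [mul_one]
  have hz : g ^ k • z = 0 := by
    rw [hsm, Ideal.Quotient.eq_zero_iff_mem]
    exact Ideal.mem_span_singleton_self _
  let v : Fin k × Fin g.natDegree → N := fun q => (X ^ (q.2 : ℕ) * g ^ (q.1 : ℕ)) • z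
  have hact : ∀ q, (X : F[X]) • v q = ∑ p, genJordanBlock g k p q • v p :=
    fun q => gj_block_action g hg k z hz q
  have hd : 0 < g.natDegree := hi.natDegree_pos
  have hgk : (g ^ k).Monic := hg.pow k
  have hcard : Fintype.card (Fin k × Fin g.natDegree) = Module.finrank F N := by
    rw [finrank_quotient_span_eq_natDegree]
    simp [hg.natDegree_pow]
  have hX : ∀ w ∈ Submodule.span F (Set.range v),
      (X : F[X]) • w ∈ Submodule.span F (Set.range v) := by
    intro w hw
    induction hw using Submodule.span_induction with
    | mem x hx =>
      obtain ⟨q, rfl⟩ := hx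
      rw [hact]
      exact Submodule.sum_mem _ fun p _ => Submodule.smul_mem _ _ (Submodule.subset_span ⟨p, rfl⟩)
    | zero => simp
    | add x y _ _ hx hy => rw [smul_add]; exact Submodule.add_mem _ hx hy
    | smul c x _ hx => rw [smul_comm]; exact Submodule.smul_mem _ _ hx
  have hz0 : z ∈ Submodule.span F (Set.range v) := by
    rcases Nat.eq_zero_or_pos k with rfl | hk
    · have : z = 0 := by simpa using hz
      rw [this]; exact Submodule.zero_mem _
    · refine Submodule.subset_span ⟨(⟨0, hk⟩, ⟨0, hd⟩), ?_⟩
      simp [v]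
  have hspan : ⊤ ≤ Submodule.span F (Set.range v) := by
    intro w _
    obtain ⟨h, rfl⟩ := Ideal.Quotient.mk_surjective w
    rw [← hsm]
    induction h using Polynomial.induction_on' with
    | add p q hp hq => rw [add_smul]; exact Submodule.add_mem _ (hp trivial) (hq trivial)
    | monomial n a =>
      rw [← C_mul_X_pow_eq_monomial, ← smul_eq_C_mul, smul_assoc]
      refine Submodule.smul_mem _ _ ?_
      induction n with
      | zero => simpa using hz0
      | succ n ih => rw [pow_succ', mul_smul]; exact hX _ (ih trivial)
  refine ⟨basisOfTopLeSpanOfCardEqFinrank v hspan hcard, fun q => ?_⟩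
  simp only [coe_basisOfTopLeSpanOfCardEqFinrank]
  exact hact q

theorem gj_exists_basis {F : Type*} [Field F] (n : ℕ) (f : Module.End F (Fin n → F)) :
    ∃ (p : ℕ) (g : Fin p → F[X]) (k : Fin p → ℕ),
      (∀ i, (g i).Monic ∧ Irreducible (g i) ∧ 1 ≤ k i) ∧
      ∃ b : Module.Basis (Σ i : Fin p, Fin (k i) × Fin ((g i).natDegree)) F (Fin n → F),
        ∀ i q, f (b ⟨i, q⟩) = ∑ r, genJordanBlock (g i) (k i) r q • b ⟨i, r⟩ := by
  classical
  have hT : Module.IsTorsion F[X] (Module.AEval' f) :=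
    Module.AEval.isTorsion_of_finiteDimensional F (Fin n → F) f
  obtain ⟨ι, _, P, hP, e, ⟨φ⟩⟩ := Module.equiv_directSum_of_isTorsion hT
  let g : ι → F[X] := fun i => normalize (P i)
  have hg : ∀ i, (g i).Monic := fun i => monic_normalize (hP i).ne_zero
  have hgi : ∀ i, Irreducible (g i) := fun i =>
    (normalize_associated (P i)).symm.irreducible (hP i)
  have hB : ∀ i, ∃ b : Module.Basis (Fin (e i) × Fin (g i).natDegree) F
      (F[X] ⧸ Submodule.span F[X] {P i ^ e i}),
      ∀ q, (X : F[X]) • b q = ∑ p, genJordanBlock (g i) (e i) p q • b p := fun i =>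
    gj_block_basis (g i) (hg i) (hgi i) (e i) _
      (Ideal.span_singleton_eq_span_singleton.2
        ((normalize_associated (P i)).symm.pow_pow))
  choose B hB using hB
  let ψ := φ.trans (DirectSum.linearEquivFunOnFintype F[X] ι
    (fun i => F[X] ⧸ Submodule.span F[X] {P i ^ e i}))
  let ψF := (Module.AEval'.of f).trans (ψ.restrictScalars F)
  let b0 : Module.Basis (Σ i, Fin (e i) × Fin (g i).natDegree) F (Fin n → F) :=
    (Pi.basis B).map ψF.symm
  have hψ : ∀ v, ψF (f v) = (X : F[X]) • ψF v := by
    intro v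
    change ψ (Module.AEval'.of f (f v)) = X • ψ (Module.AEval'.of f v)
    rw [← Module.AEval'.X_smul_of, map_smul]
  have hb0 : ∀ i q, ψF (b0 ⟨i, q⟩) = Pi.single i (B i q) := by
    intro i q
    simp [b0]
  have hact : ∀ i q, f (b0 ⟨i, q⟩) = ∑ r, genJordanBlock (g i) (e i) r q • b0 ⟨i, r⟩ := by
    intro i q
    apply ψF.injective
    rw [hψ, map_sum]
    simp only [map_smul, hb0]
    funext j
    rw [Finset.sum_apply, Pi.smul_apply]
    by_cases h : j = i
    · subst h
      simp only [Pi.smul_apply, Pi.single_eq_same]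
      exact hB j q
    · simp only [Pi.smul_apply, Pi.single_eq_of_ne h, smul_zero, Finset.sum_const_zero]
  -- remove the trivial blocks
  let σ : Fin (Fintype.card {i // 0 < e i}) ≃ {i // 0 < e i} := (Fintype.equivFin _).symm
  let τ : (Σ j, Fin (e (σ j).1) × Fin (g (σ j).1).natDegree) →
      (Σ i, Fin (e i) × Fin (g i).natDegree) := fun x => ⟨(σ x.1).1, x.2⟩
  have hτ : Function.Bijective τ := by
    constructor
    · have : Function.Injective fun j => (σ j).1 := Subtype.val_injective.comp σ.injective
      exact Function.Injective.sigma_map (β₂ := fun i => Fin (e i) × Fin (g i).natDegree)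
        (f₂ := fun _ => id) this (fun _ => Function.injective_id)
    · rintro ⟨i, q⟩
      obtain ⟨j, hj⟩ := σ.surjective ⟨i, q.1.pos⟩
      have hj' : (σ j).1 = i := congrArg Subtype.val hj
      subst hj'
      exact ⟨⟨j, q⟩, rfl⟩
  refine ⟨_, fun j => g (σ j).1, fun j => e (σ j).1,
    fun j => ⟨hg _, hgi _, (σ j).2⟩, b0.reindex (Equiv.ofBijective τ hτ).symm, ?_⟩
  intro i q
  simp only [Module.Basis.reindex_apply, Equiv.symm_symm, Equiv.ofBijective_apply]
  exact hact _ _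

theorem stmt7 {F : Type*} [Field F] (n : ℕ) (M : Matrix (Fin n) (Fin n) F) :
    ∃ (p : ℕ) (g : Fin p → Polynomial F) (k : Fin p → ℕ),
      (∀ i, (g i).Monic ∧ Irreducible (g i) ∧ 1 ≤ k i) ∧
      ∃ (e : Fin n ≃ (Σ i : Fin p, Fin (k i) × Fin ((g i).natDegree)))
        (S : (Matrix (Fin n) (Fin n) F)ˣ),
        M = S.val * (Matrix.reindex e.symm e.symm
          (Matrix.blockDiagonal' fun i => genJordanBlock (g i) (k i))) * S⁻¹.val := by
  obtain ⟨p, g, k, h, b, hb⟩ := gj_exists_basis n (Matrix.toLin' M)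
  refine ⟨p, g, k, h, ?_⟩
  let s := Pi.basisFun F (Fin n)
  let e := s.indexEquiv b
  let b' := b.reindex e.symm
  refine ⟨e, ⟨s.toMatrix b', b'.toMatrix s, s.toMatrix_mul_toMatrix_flip b',
    b'.toMatrix_mul_toMatrix_flip s⟩, ?_⟩
  have hJ : Matrix.reindex e.symm e.symm
      (Matrix.blockDiagonal' fun i => genJordanBlock (g i) (k i)) =
      LinearMap.toMatrix b' b' (Matrix.toLin' M) := by
    ext x y
    obtain ⟨⟨i, r⟩, rfl⟩ := e.symm.surjective x
    obtain ⟨⟨j, q⟩, rfl⟩ := e.symm.surjective y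
    rw [LinearMap.toMatrix_apply]
    simp only [b', Module.Basis.reindex_apply, Equiv.symm_symm, Equiv.apply_symm_apply,
      Matrix.reindex_apply, Matrix.submatrix_apply, hb, Module.Basis.repr_reindex_apply]
    simp only [map_sum, map_smul, Module.Basis.repr_self, Finsupp.coe_finsetSum,
      Finset.sum_apply, Finsupp.smul_apply, smul_eq_mul]
    by_cases hij : i = j
    · subst hij
      rw [Matrix.blockDiagonal'_apply_eq, Finset.sum_eq_single r]
      · simp
      · intro r' _ hr
        rw [Finsupp.single_eq_of_ne (by simpa using hr.symm), mul_zero]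
      · simp
    · rw [Matrix.blockDiagonal'_apply_ne _ _ _ hij, Finset.sum_eq_zero]
      intro r' _
      rw [Finsupp.single_eq_of_ne (fun h => hij (congrArg Sigma.fst h)), mul_zero]
  rw [hJ]
  change M = s.toMatrix b' * _ * b'.toMatrix s
  rw [basis_toMatrix_mul_linearMap_toMatrix_mul_basis_toMatrix]
  exact (LinearMap.toMatrix'_toLin' M).symm
end

section
/- Let A be an endomorphism of a finite-dimensional vector space over a field F, f ∈ F[x] monic irreducible of degree d, and for j ≥ 0 set nⱼ = dim ker (f(A))ʲ. Suppose V decomposes as a direct sum of A-invariant subspaces on which A acts as in the generalized Jordan form. Then the number of generalized Jordan blocks for f of size j·d equals (2nⱼ − n_{j−1} − n_{j+1})/d. -/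
open Polynomial in
theorem aux_aeval_comm {F V W : Type*} [Field F] [AddCommGroup V] [Module F V]
    [AddCommGroup W] [Module F W] (T : Module.End F V) (N : Module.End F W) (π : V →ₗ[F] W)
    (h : ∀ v, π (T v) = N (π v)) (q : F[X]) (v : V) :
    π (aeval T q v) = aeval N q (π v) := by
  have hp : ∀ (m : ℕ) (v : V), π ((T ^ m) v) = (N ^ m) (π v) := by
    intro m
    induction m with
    | zero => intro v; simp
    | succ m ih => intro v; rw [pow_succ, pow_succ, Module.End.mul_apply, ih, h]; rfl
  induction q using Polynomial.induction_on' with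
  | add a b ha hb => simp [ha, hb]
  | monomial m a => simp [aeval_monomial, Module.algebraMap_end_apply, hp]

/-- basis vectors indexed by natural numbers, zero out of range -/
def auxE (F : Type*) [Field F] (k d : ℕ) (c i : ℕ) : Fin k × Fin d → F := fun p =>
  if (p.1 : ℕ) = c ∧ (p.2 : ℕ) = i then 1 else 0

theorem auxE_single (F : Type*) [Field F] (k d : ℕ) (c : Fin k) (i : Fin d) :
    auxE F k d c i = Pi.single (c, i) 1 := by
  ext ⟨a, b⟩
  simp [auxE, Pi.single_apply, Fin.ext_iff]

theorem auxE_zero (F : Type*) [Field F] (k d : ℕ) (c i : ℕ) (h : k ≤ c) :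
    auxE F k d c i = 0 := by
  ext ⟨a, b⟩
  have := a.2
  simp only [auxE, Pi.zero_apply, ite_eq_right_iff]
  intro h; omega

theorem aux_N_low {F : Type*} [Field F] (g : Polynomial F) (k c i : ℕ)
    (hi : i + 1 < g.natDegree) :
    (genJordanBlock g k).mulVecLin (auxE F k g.natDegree c i) = auxE F k g.natDegree c (i + 1) := by
  by_cases hc : c < k
  · rw [show auxE F k g.natDegree c i = _ from auxE_single F k g.natDegree ⟨c, hc⟩ ⟨i, by omega⟩]
    rw [Matrix.mulVecLin_apply, Matrix.mulVec_single_one]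
    ext ⟨a, b⟩
    simp only [Matrix.col_apply, genJordanBlock, companionMatrix, auxE, Fin.ext_iff]
    split_ifs <;> first | rfl | omega
  · rw [auxE_zero _ _ _ _ _ (by omega), auxE_zero _ _ _ _ _ (by omega), map_zero]

theorem aux_N_top {F : Type*} [Field F] (g : Polynomial F) (k c : ℕ)
    (hg : 1 ≤ g.natDegree) :
    (genJordanBlock g k).mulVecLin (auxE F k g.natDegree c (g.natDegree - 1)) =
      auxE F k g.natDegree (c + 1) 0
        - ∑ i ∈ Finset.range g.natDegree, g.coeff i • auxE F k g.natDegree c i := by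
  by_cases hc : c < k
  · rw [show auxE F k g.natDegree c (g.natDegree - 1) = _ from
      auxE_single F k g.natDegree ⟨c, hc⟩ ⟨g.natDegree - 1, by omega⟩]
    rw [Matrix.mulVecLin_apply, Matrix.mulVec_single_one]
    ext ⟨a, b⟩
    have hb := b.2
    have hs : (∑ i ∈ Finset.range g.natDegree, g.coeff i • auxE F k g.natDegree c i) (a, b)
        = if (a : ℕ) = c then g.coeff b else 0 := by
      rw [Finset.sum_apply, Finset.sum_eq_single (b : ℕ)]
      · simp [auxE]
      · intro i _ hi
        simp [auxE, hi.symm]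
      · intro h; simp at h
    rw [Pi.sub_apply, hs]
    simp only [Matrix.col_apply, genJordanBlock, companionMatrix, auxE, Fin.ext_iff]
    split_ifs <;> first | omega | (simp; done) | (exfalso; simp_all; done)
  · simp [auxE_zero F k g.natDegree c _ (by omega), auxE_zero F k g.natDegree (c+1) _ (by omega)]

theorem aux_N_pow {F : Type*} [Field F] (g : Polynomial F) (k c i : ℕ)
    (hi : i < g.natDegree) :
    ((genJordanBlock g k).mulVecLin ^ i) (auxE F k g.natDegree c 0) = auxE F k g.natDegree c i := by
  induction i with
  | zero => simp
  | succ i ih => rw [pow_succ', Module.End.mul_apply, ih (by omega), aux_N_low _ _ _ _ hi]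

open Polynomial in
theorem aux_gN_zero {F : Type*} [Field F] (g : Polynomial F) (k c : ℕ) (hm : g.Monic)
    (hg : 1 ≤ g.natDegree) :
    (aeval (genJordanBlock g k).mulVecLin g) (auxE F k g.natDegree c 0)
      = auxE F k g.natDegree (c + 1) 0 := by
  have hpow : ((genJordanBlock g k).mulVecLin ^ g.natDegree) (auxE F k g.natDegree c 0) =
      auxE F k g.natDegree (c + 1) 0
        - ∑ i ∈ Finset.range g.natDegree, g.coeff i • auxE F k g.natDegree c i := by
    rw [← aux_N_top g k c hg, ← aux_N_pow g k c (g.natDegree - 1) (by omega),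
      ← Module.End.mul_apply, ← pow_succ', Nat.sub_add_cancel hg]
  rw [aeval_eq_sum_range, Finset.sum_range_succ, LinearMap.add_apply, LinearMap.sum_apply,
    LinearMap.smul_apply, hpow, hm.coeff_natDegree, one_smul]
  rw [Finset.sum_congr rfl (g := fun i => g.coeff i • auxE F k g.natDegree c i)]
  · abel
  · intro i hi
    rw [LinearMap.smul_apply, aux_N_pow g k c i (Finset.mem_range.1 hi)]

open Polynomial in
theorem aux_gN_pow {F : Type*} [Field F] (g : Polynomial F) (k c i j : ℕ) (hm : g.Monic)
    (hi : i < g.natDegree) :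
    ((aeval (genJordanBlock g k).mulVecLin g) ^ j) (auxE F k g.natDegree c i)
      = auxE F k g.natDegree (c + j) i := by
  induction j with
  | zero => simp
  | succ j ih =>
    rw [pow_succ', Module.End.mul_apply, ih, ← aux_N_pow g k (c + j) i hi,
      ← Module.End.mul_apply]
    have hcomm : Commute (aeval (genJordanBlock g k).mulVecLin g)
        ((genJordanBlock g k).mulVecLin ^ i) := by
      have := (Polynomial.commute_X_pow g i).symm.map (aeval (genJordanBlock g k).mulVecLin)
      simpa using this
    rw [hcomm.eq, Module.End.mul_apply, aux_gN_zero g k _ hm (by omega), aux_N_pow g k _ i hi]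
    rfl

open Polynomial in
theorem aux_gN_apply {F : Type*} [Field F] (g : Polynomial F) (k j : ℕ) (hm : g.Monic)
    (v : Fin k × Fin g.natDegree → F) :
    ((aeval (genJordanBlock g k).mulVecLin g) ^ j) v
      = ∑ p, v p • auxE F k g.natDegree (p.1 + j) p.2 := by
  conv_lhs => rw [pi_eq_sum_univ' v]
  rw [map_sum]
  refine Finset.sum_congr rfl fun p _ => ?_
  rw [map_smul, ← aux_gN_pow g k p.1 p.2 j hm p.2.2, auxE_single]

open Polynomial in
theorem aux_finrank_same {F : Type*} [Field F] (g : Polynomial F) (k j : ℕ) (hm : g.Monic) :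
    Module.finrank F (LinearMap.ker ((aeval (genJordanBlock g k).mulVecLin g) ^ j))
      = min j k * g.natDegree := by
  let φ : Fin (k - j) × Fin g.natDegree → Fin k × Fin g.natDegree :=
    fun p => (Fin.castLE (Nat.sub_le k j) p.1, p.2)
  have hφ : Function.Injective φ := by
    rintro ⟨a, b⟩ ⟨a', b'⟩ h
    simpa [φ] using h
  have hker : LinearMap.ker ((aeval (genJordanBlock g k).mulVecLin g) ^ j)
      = LinearMap.ker (LinearMap.funLeft F F φ) := by
    ext v
    rw [LinearMap.mem_ker, LinearMap.mem_ker, aux_gN_apply g k j hm]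
    constructor
    · intro h
      ext ⟨a, b⟩
      have ha := a.2
      have h1 := congrFun h (⟨a + j, by omega⟩, b)
      rw [Finset.sum_apply, Finset.sum_eq_single (φ (a, b))] at h1
      · simpa [auxE, φ] using h1
      · rintro ⟨a', b'⟩ _ hne
        have : ¬ ((a : ℕ) = a' ∧ (b : ℕ) = b') := by
          rintro ⟨h2, h3⟩
          apply hne
          simp only [φ, Prod.mk.injEq, Fin.ext_iff, Fin.val_castLE]
          omega
        simp [auxE]
        intro h2 h3
        exact absurd ⟨h2, by rw [h3]⟩ this
      · simp
    · intro h
      refine Finset.sum_eq_zero ?_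
      rintro ⟨a, b⟩ _
      by_cases hk : k ≤ a + j
      · rw [auxE_zero _ _ _ _ _ hk, smul_zero]
      · have h1 := congrFun h (⟨a, by omega⟩, b)
        have h2 : v (a, b) = 0 := h1
        rw [h2, zero_smul]
  rw [hker]
  have hr := LinearMap.finrank_range_add_finrank_ker (LinearMap.funLeft F F φ)
  rw [LinearMap.range_eq_top.2 (LinearMap.funLeft_surjective_of_injective F F φ hφ),
    finrank_top, Module.finrank_fintype_fun_eq_card, Module.finrank_fintype_fun_eq_card] at hr
  simp only [Fintype.card_prod, Fintype.card_fin] at hr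
  have : k = (k - j) + min j k := by omega
  have h3 : k * g.natDegree = (k - j) * g.natDegree + min j k * g.natDegree := by
    rw [← add_mul, ← this]
  omega

open Polynomial in
theorem aux_finrank_ne {F : Type*} [Field F] (g f : Polynomial F) (k j : ℕ) (hm : g.Monic)
    (hi : Irreducible g) (hf : f.Monic) (hfi : Irreducible f) (hne : g ≠ f) :
    Module.finrank F (LinearMap.ker ((aeval (genJordanBlock g k).mulVecLin f) ^ j)) = 0 := by
  have hco : IsCoprime f g := by
    rw [hfi.coprime_iff_not_dvd]
    intro h
    exact hne (eq_of_monic_of_associated hf hm (hfi.associated_of_dvd hi h)).symm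
  obtain ⟨a, b, hab⟩ := (hco.pow (m := j) (n := k))
  have hz : (aeval (genJordanBlock g k).mulVecLin g) ^ k = 0 := by
    refine LinearMap.ext fun v => ?_
    simp [aux_gN_apply g k k hm, auxE_zero]
  have hbot : LinearMap.ker ((aeval (genJordanBlock g k).mulVecLin f) ^ j) = ⊥ := by
    rw [eq_bot_iff]
    intro v hv
    have := congrArg (fun q => aeval (genJordanBlock g k).mulVecLin q v) hab
    simp only [map_add, map_mul, map_pow, hz, mul_zero, add_zero, map_one,
      Module.End.mul_apply, Module.End.one_apply, LinearMap.mem_ker.1 hv, map_zero] at this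
    simpa using this.symm
  rw [hbot, finrank_bot]

open Polynomial in
theorem aux_finrank_block {F : Type*} [Field F] {p : ℕ} (g : Fin p → F[X]) (k : Fin p → ℕ)
    (q : F[X]) :
    Module.finrank F (LinearMap.ker (aeval
      (Matrix.blockDiagonal' fun i => genJordanBlock (g i) (k i)).mulVecLin q))
    = ∑ i, Module.finrank F (LinearMap.ker (aeval (genJordanBlock (g i) (k i)).mulVecLin q)) := by
  set T := (Matrix.blockDiagonal' fun i => genJordanBlock (g i) (k i)).mulVecLin with hT
  let π : ∀ i, ((Σ i : Fin p, Fin (k i) × Fin ((g i).natDegree)) → F) →ₗ[F]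
      (Fin (k i) × Fin ((g i).natDegree) → F) := fun i => LinearMap.funLeft F F (fun x => ⟨i, x⟩)
  have hπ : ∀ i v, π i (T v) = (genJordanBlock (g i) (k i)).mulVecLin (π i v) := by
    intro i v
    ext x
    simp only [π, LinearMap.funLeft_apply, hT, Matrix.mulVecLin_apply, Matrix.mulVec, dotProduct]
    rw [Fintype.sum_sigma, Finset.sum_eq_single i]
    · simp [Matrix.blockDiagonal'_apply_eq]
    · intro i' _ hne
      refine Finset.sum_eq_zero fun y _ => ?_
      rw [Matrix.blockDiagonal'_apply_ne _ _ _ hne.symm, zero_mul]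
    · simp
  have hq := fun i => aux_aeval_comm T _ (π i) (hπ i) q
  rw [← Module.finrank_pi_fintype]
  refine LinearEquiv.finrank_eq
    { toFun := fun v i => ⟨π i v, by rw [LinearMap.mem_ker, ← hq, LinearMap.mem_ker.1 v.2, map_zero]⟩
      map_add' := fun v w => by ext; simp
      map_smul' := fun a v => by ext; simp
      invFun := fun w => ⟨fun x => (w x.1).1 x.2, by
        rw [LinearMap.mem_ker]
        ext ⟨i, x⟩
        have h1 := hq i (fun x => (w x.1).1 x.2)
        have h2 : π i (fun x => (w x.1).1 x.2) = (w i).1 := rfl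
        rw [h2, LinearMap.mem_ker.1 (w i).2] at h1
        exact congrFun h1 x⟩
      left_inv := fun v => rfl
      right_inv := fun w => rfl }

theorem stmt8 {F : Type*} [Field F] (p : ℕ)
    (g : Fin p → Polynomial F) (k : Fin p → ℕ)
    (hg : ∀ i, (g i).Monic ∧ Irreducible (g i) ∧ 1 ≤ k i)
    (f : Polynomial F) (hf : f.Monic) (hirr : Irreducible f)
    (d : ℕ) (hd : f.natDegree = d)
    (M : Matrix (Σ i : Fin p, Fin (k i) × Fin ((g i).natDegree))
                (Σ i : Fin p, Fin (k i) × Fin ((g i).natDegree)) F)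
    (hM : M = Matrix.blockDiagonal' fun i => genJordanBlock (g i) (k i))
    (n : ℕ → ℕ)
    (hn : ∀ j, n j = Module.finrank F
      (LinearMap.ker ((Polynomial.aeval M.mulVecLin f) ^ j)))
    (j : ℕ) (hj : 1 ≤ j) :
    (Nat.card {i : Fin p // g i = f ∧ k i = j} * d : ℤ)
      = 2 * (n j : ℤ) - (n (j - 1) : ℤ) - (n (j + 1) : ℤ) := by
  classical
  have key : ∀ j, n j = ∑ i, if g i = f then min j (k i) * d else 0 := by
    intro j
    rw [hn, hM, ← map_pow, aux_finrank_block]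
    refine Finset.sum_congr rfl fun i _ => ?_
    rw [map_pow]
    split_ifs with h
    · rw [← hd, ← h]
      exact aux_finrank_same (g i) (k i) j (hg i).1
    · exact aux_finrank_ne (g i) f (k i) j (hg i).1 (hg i).2.1 hf hirr h
  rw [Nat.card_eq_fintype_card, Fintype.card_subtype, Finset.card_filter, key, key, key]
  push_cast
  rw [Finset.sum_mul, Finset.mul_sum, ← Finset.sum_sub_distrib, ← Finset.sum_sub_distrib]
  refine Finset.sum_congr rfl fun i _ => ?_
  by_cases h : g i = f
  · simp only [h, true_and, if_true]
    have h1 : (if k i = j then (1 : ℤ) else 0) =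
        2 * min (j : ℤ) (k i) - min ((j - 1 : ℕ) : ℤ) (k i) - min ((j : ℤ) + 1) (k i) := by
      split_ifs <;> omega
    rw [h1]
    ring
  · simp [h]
end

section
/- The generalized Jordan normal form over a field F of a linear endomorphism A of a finite-dimensional F-vector space is unique up to reordering of the blocks: if A is similar to two block-diagonal matrices in generalized Jordan form, then the two collections of blocks coincide as multisets. -/
open Matrix Polynomial in
/-- Standard basis vectors indexed by natural numbers (zero when out of range). -/
def gjVec (F : Type*) [Field F] (k d : ℕ) (a j : ℕ) : Fin k × Fin d → F := fun p =>
  if (p.1 : ℕ) = a ∧ (p.2 : ℕ) = j then 1 else 0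

theorem gjVec_eq_single {F : Type*} [Field F] {k d : ℕ} (a : Fin k) (j : Fin d) :
    gjVec F k d a j = Pi.single (a, j) 1 := by
  ext p
  simp only [gjVec, Pi.single_apply, Prod.ext_iff, Fin.ext_iff]

theorem gjVec_eq_zero {F : Type*} [Field F] {k d : ℕ} {a j : ℕ} (h : k ≤ a) :
    gjVec F k d a j = 0 := by
  ext p
  have := p.1.2
  simp only [gjVec, Pi.zero_apply, ite_eq_right_iff]
  omega

open Matrix Polynomial in
theorem gj_mulVec_lt {F : Type*} [Field F] (g : Polynomial F) (k a j : ℕ)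
    (hj : j + 1 < g.natDegree) :
    genJordanBlock g k *ᵥ gjVec F k g.natDegree a j = gjVec F k g.natDegree a (j + 1) := by
  rcases lt_or_ge a k with ha | ha
  · have := gjVec_eq_single (F := F) (⟨a, ha⟩ : Fin k) (⟨j, by omega⟩ : Fin g.natDegree)
    simp only at this
    rw [this, Matrix.mulVec_single_one]
    ext p
    simp only [Matrix.col_apply, genJordanBlock, companionMatrix, gjVec, Fin.ext_iff]
    split_ifs <;> first | rfl | omega
  · rw [gjVec_eq_zero ha, gjVec_eq_zero ha, Matrix.mulVec_zero]

open Matrix Polynomial in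
theorem gj_mulVec_last {F : Type*} [Field F] (g : Polynomial F) (k a : ℕ)
    (hd : 0 < g.natDegree) :
    genJordanBlock g k *ᵥ gjVec F k g.natDegree a (g.natDegree - 1) =
      gjVec F k g.natDegree (a + 1) 0 -
        ∑ i ∈ Finset.range g.natDegree, g.coeff i • gjVec F k g.natDegree a i := by
  rcases lt_or_ge a k with ha | ha
  · have := gjVec_eq_single (F := F) (⟨a, ha⟩ : Fin k)
      (⟨g.natDegree - 1, by omega⟩ : Fin g.natDegree)
    simp only at this
    rw [this, Matrix.mulVec_single_one]
    ext p
    have hp := p.2.2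
    have hs : ∑ i ∈ Finset.range g.natDegree, g.coeff i * gjVec F k g.natDegree a i p =
        if (p.1 : ℕ) = a then g.coeff p.2 else 0 := by
      rw [Finset.sum_eq_single (p.2 : ℕ)]
      · simp [gjVec]
      · intro b _ hb
        simp [gjVec, hb.symm]
      · intro h
        simp at h
    simp only [Matrix.col_apply, Pi.sub_apply, Finset.sum_apply, Pi.smul_apply, smul_eq_mul, hs]
    simp only [genJordanBlock, companionMatrix, gjVec, Fin.ext_iff]
    simp only [and_true]
    split_ifs <;> first | omega | simp
  · simp [gjVec_eq_zero ha, gjVec_eq_zero (show k ≤ a + 1 by omega)]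

open Matrix Polynomial in
theorem gj_pow_mulVec {F : Type*} [Field F] (g : Polynomial F) (k a j : ℕ)
    (hj : j < g.natDegree) :
    (genJordanBlock g k ^ j) *ᵥ gjVec F k g.natDegree a 0 = gjVec F k g.natDegree a j := by
  induction j with
  | zero => simp
  | succ j ih =>
    rw [pow_succ', ← Matrix.mulVec_mulVec, ih (by omega), gj_mulVec_lt g k a j hj]

open Matrix Polynomial in
theorem gj_aeval_mulVec_zero {F : Type*} [Field F] (g : Polynomial F) (hg : g.Monic) (k a : ℕ)
    (hd : 0 < g.natDegree) :
    (aeval (genJordanBlock g k) g) *ᵥ gjVec F k g.natDegree a 0 =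
      gjVec F k g.natDegree (a + 1) 0 := by
  rw [Polynomial.aeval_eq_sum_range, Finset.sum_range_succ, Matrix.add_mulVec, Matrix.sum_mulVec,
    hg.coeff_natDegree, one_smul]
  have h1 : (genJordanBlock g k ^ g.natDegree) *ᵥ gjVec F k g.natDegree a 0 =
      gjVec F k g.natDegree (a + 1) 0 -
        ∑ i ∈ Finset.range g.natDegree, g.coeff i • gjVec F k g.natDegree a i := by
    obtain ⟨n, hn⟩ : ∃ n, g.natDegree = n + 1 := ⟨g.natDegree - 1, by omega⟩
    have : genJordanBlock g k ^ g.natDegree =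
        genJordanBlock g k * genJordanBlock g k ^ (g.natDegree - 1) := by
      rw [← pow_succ', Nat.sub_add_cancel hd]
    rw [this, ← Matrix.mulVec_mulVec, gj_pow_mulVec g k a _ (by omega), gj_mulVec_last g k a hd]
  rw [h1]
  have h2 : ∀ i ∈ Finset.range g.natDegree,
      (g.coeff i • genJordanBlock g k ^ i) *ᵥ gjVec F k g.natDegree a 0 =
        g.coeff i • gjVec F k g.natDegree a i := by
    intro i hi
    rw [Matrix.smul_mulVec, gj_pow_mulVec g k a i (Finset.mem_range.1 hi)]
  rw [Finset.sum_congr rfl h2]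
  abel

open Matrix Polynomial in
theorem gj_aeval_mulVec {F : Type*} [Field F] (g : Polynomial F) (hg : g.Monic) (k a j : ℕ)
    (hj : j < g.natDegree) :
    (aeval (genJordanBlock g k) g) *ᵥ gjVec F k g.natDegree a j =
      gjVec F k g.natDegree (a + 1) j := by
  have hc : aeval (genJordanBlock g k) g * genJordanBlock g k ^ j =
      genJordanBlock g k ^ j * aeval (genJordanBlock g k) g := by
    have h1 : genJordanBlock g k ^ j = aeval (genJordanBlock g k) ((X : F[X]) ^ j) := by simp
    rw [h1, ← map_mul, ← map_mul, mul_comm]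
  rw [← gj_pow_mulVec g k a j hj, Matrix.mulVec_mulVec, hc, ← Matrix.mulVec_mulVec,
    gj_aeval_mulVec_zero g hg k a (by omega), gj_pow_mulVec g k (a + 1) j hj]

open Matrix Polynomial in
theorem gj_aeval_pow_mulVec {F : Type*} [Field F] (g : Polynomial F) (hg : g.Monic)
    (k a j m : ℕ) (hj : j < g.natDegree) :
    (aeval (genJordanBlock g k) (g ^ m)) *ᵥ gjVec F k g.natDegree a j =
      gjVec F k g.natDegree (a + m) j := by
  induction m with
  | zero => simp
  | succ m ih =>
    rw [pow_succ', map_mul, ← Matrix.mulVec_mulVec, ih, gj_aeval_mulVec g hg k _ j hj, add_assoc]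

open Matrix Polynomial in
theorem gj_aeval_pow_col {F : Type*} [Field F] (g : Polynomial F) (hg : g.Monic)
    (k m : ℕ) (p : Fin k × Fin g.natDegree) :
    (aeval (genJordanBlock g k) (g ^ m)).col p = gjVec F k g.natDegree (p.1 + m) p.2 := by
  rw [← gj_aeval_pow_mulVec g hg k p.1 p.2 m p.2.2, gjVec_eq_single, Matrix.mulVec_single_one]

open Matrix Polynomial in
theorem gj_aeval_pow_eq_zero {F : Type*} [Field F] (g : Polynomial F) (hg : g.Monic) (k : ℕ) :
    aeval (genJordanBlock g k) (g ^ k) = 0 := by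
  ext i p
  have := congrFun (gj_aeval_pow_col g hg k k p) i
  rw [gjVec_eq_zero (by omega)] at this
  exact this

open Matrix Polynomial in
theorem gj_rank {F : Type*} [Field F] (g : Polynomial F) (hg : g.Monic) (k m : ℕ) :
    (aeval (genJordanBlock g k) (g ^ m)).rank = (k - m) * g.natDegree := by
  rw [Matrix.rank_eq_finrank_span_cols]
  let φ : Fin (k - m) × Fin g.natDegree → Fin k × Fin g.natDegree := fun p =>
    (⟨p.1 + m, by omega⟩, p.2)
  have hφ : Function.Injective φ := by
    rintro ⟨a, b⟩ ⟨c, d⟩ h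
    simp only [φ, Prod.mk.injEq, Fin.mk.injEq, Fin.ext_iff] at h ⊢
    omega
  let b : Fin (k - m) × Fin g.natDegree → (Fin k × Fin g.natDegree → F) := fun p =>
    Pi.basisFun F _ (φ p)
  have hb : LinearIndependent F b :=
    (Pi.basisFun F (Fin k × Fin g.natDegree)).linearIndependent.comp φ hφ
  have hbv : ∀ p, b p = gjVec F k g.natDegree (p.1 + m) p.2 := by
    intro p
    simp only [b, φ, Pi.basisFun_apply]
    rw [← gjVec_eq_single]
  have hspan : Submodule.span F (Set.range (aeval (genJordanBlock g k) (g ^ m)).col) =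
      Submodule.span F (Set.range b) := by
    apply le_antisymm
    · rw [Submodule.span_le]
      rintro _ ⟨p, rfl⟩
      rw [gj_aeval_pow_col g hg]
      rcases lt_or_ge (p.1 + m : ℕ) k with h | h
      · apply Submodule.subset_span
        exact ⟨(⟨p.1, by omega⟩, p.2), hbv _⟩
      · rw [gjVec_eq_zero h]
        exact Submodule.zero_mem _
    · rw [Submodule.span_le]
      rintro _ ⟨p, rfl⟩
      apply Submodule.subset_span
      refine ⟨(⟨p.1, by omega⟩, p.2), ?_⟩
      rw [gj_aeval_pow_col g hg, hbv]
  rw [hspan, finrank_span_eq_card hb]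
  simp

open Matrix Polynomial in
/-- Nullity of a square matrix. -/
noncomputable def gjNull {F : Type*} [Field F] {n : Type*} [Fintype n] (A : Matrix n n F) : ℕ :=
  Module.finrank F (LinearMap.ker A.mulVecLin)

open Matrix Polynomial in
theorem gjNull_add_rank {F : Type*} [Field F] {n : Type*} [Fintype n] (A : Matrix n n F) :
    A.rank + gjNull A = Fintype.card n := by
  have := A.mulVecLin.finrank_range_add_finrank_ker
  rw [Module.finrank_pi] at this
  exact this

open Matrix Polynomial in
theorem gjNull_block_same {F : Type*} [Field F] (g : Polynomial F) (hg : g.Monic) (k m : ℕ) :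
    gjNull (aeval (genJordanBlock g k) (g ^ m)) = min m k * g.natDegree := by
  have h := gjNull_add_rank (aeval (genJordanBlock g k) (g ^ m))
  rw [gj_rank g hg] at h
  simp only [Fintype.card_prod, Fintype.card_fin] at h
  have : k * g.natDegree = (k - m) * g.natDegree + min m k * g.natDegree := by
    rw [← add_mul]
    congr 1
    omega
  omega

open Matrix Polynomial in
theorem gjNull_block_ne {F : Type*} [Field F] (g h : Polynomial F) (hg : g.Monic)
    (hgi : Irreducible g) (hh : h.Monic) (hhi : Irreducible h) (hne : g ≠ h) (k m : ℕ) :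
    gjNull (aeval (genJordanBlock g k) (h ^ m)) = 0 := by
  have hco : IsCoprime (h ^ m) (g ^ k) := by
    apply IsCoprime.pow
    rw [hhi.coprime_iff_not_dvd]
    intro hd
    exact hne (Polynomial.eq_of_monic_of_associated hg hh (hhi.associated_of_dvd hgi hd).symm)
  obtain ⟨a, b, hab⟩ := hco
  have h1 : aeval (genJordanBlock g k) a * aeval (genJordanBlock g k) (h ^ m) = 1 := by
    have := congrArg (aeval (genJordanBlock g k)) hab
    rw [map_add, map_mul, map_mul, gj_aeval_pow_eq_zero g hg, mul_zero, add_zero, map_one] at this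
    exact this
  have hu : IsUnit (aeval (genJordanBlock g k) (h ^ m)) := IsUnit.of_mul_eq_one_right _ h1
  have := gjNull_add_rank (aeval (genJordanBlock g k) (h ^ m))
  rw [Matrix.rank_of_isUnit _ hu] at this
  omega

open Matrix Polynomial in
theorem gj_aeval_blockDiagonal {F : Type*} [Field F] {o : Type*} [Fintype o] [DecidableEq o]
    {m : o → Type*} [∀ i, Fintype (m i)] [∀ i, DecidableEq (m i)]
    (A : ∀ i, Matrix (m i) (m i) F) (f : F[X]) :
    aeval (blockDiagonal' A) f = blockDiagonal' fun i => aeval (A i) f := by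
  let φ : (∀ i, Matrix (m i) (m i) F) →ₐ[F] Matrix (Σ i, m i) (Σ i, m i) F :=
    { blockDiagonal'RingHom m F with
      commutes' := by
        intro r
        change blockDiagonal' (fun i => algebraMap F (Matrix (m i) (m i) F) r) = _
        simp only [Matrix.algebraMap_eq_diagonal]
        exact blockDiagonal'_diagonal _ }
  have h1 : aeval (φ A) f = φ (aeval A f) := Polynomial.aeval_algHom_apply φ A f
  have h2 : aeval A f = fun i => aeval (A i) f := by
    funext i
    exact (Polynomial.aeval_algHom_apply (Pi.evalAlgHom F (fun i => Matrix (m i) (m i) F) i)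
      A f).symm
  rw [h2] at h1
  exact h1

open Matrix Polynomial in
theorem gj_blockDiagonal_mulVec {F : Type*} [Field F] {o : Type*} [Fintype o] [DecidableEq o]
    {m : o → Type*} [∀ i, Fintype (m i)]
    (A : ∀ i, Matrix (m i) (m i) F) (x : (Σ i, m i) → F) (i : o) (j : m i) :
    (blockDiagonal' A *ᵥ x) ⟨i, j⟩ = (A i *ᵥ fun l => x ⟨i, l⟩) j := by
  simp only [Matrix.mulVec, dotProduct]
  rw [Fintype.sum_sigma, Finset.sum_eq_single i]
  · simp [blockDiagonal'_apply_eq]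
  · intro b _ hb
    apply Finset.sum_eq_zero
    intro l _
    rw [blockDiagonal'_apply_ne _ _ _ hb.symm, zero_mul]
  · simp

open Matrix Polynomial in
theorem gjNull_blockDiagonal {F : Type*} [Field F] {o : Type*} [Fintype o] [DecidableEq o]
    {m : o → Type*} [∀ i, Fintype (m i)]
    (A : ∀ i, Matrix (m i) (m i) F) :
    gjNull (blockDiagonal' A) = ∑ i, gjNull (A i) := by
  let E : LinearMap.ker (blockDiagonal' A).mulVecLin ≃ₗ[F]
      (∀ i, LinearMap.ker (A i).mulVecLin) :=
    { toFun := fun x i => ⟨fun j => x.1 ⟨i, j⟩, by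
        have hx := x.2
        rw [LinearMap.mem_ker, Matrix.mulVecLin_apply] at hx ⊢
        ext j
        rw [← gj_blockDiagonal_mulVec, hx]
        rfl⟩
      invFun := fun y => ⟨fun s => (y s.1).1 s.2, by
        rw [LinearMap.mem_ker, Matrix.mulVecLin_apply]
        ext ⟨i, j⟩
        rw [gj_blockDiagonal_mulVec]
        have hy := (y i).2
        rw [LinearMap.mem_ker, Matrix.mulVecLin_apply] at hy
        exact congrFun hy j⟩
      map_add' := fun _ _ => rfl
      map_smul' := fun _ _ => rfl
      left_inv := fun _ => rfl
      right_inv := fun _ => rfl }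
  unfold gjNull
  rw [E.finrank_eq, Module.finrank_pi_fintype]

open Matrix Polynomial in
theorem gj_aeval_conj {F : Type*} [Field F] {n : Type*} [Fintype n] [DecidableEq n]
    (S : (Matrix n n F)ˣ) (B : Matrix n n F) (f : F[X]) :
    aeval (S.val * B * S⁻¹.val) f = S.val * aeval B f * S⁻¹.val := by
  induction f using Polynomial.induction_on' with
  | add p q hp hq => rw [map_add, map_add, hp, hq, mul_add, add_mul]
  | monomial j a =>
    rw [aeval_monomial, aeval_monomial, Units.conj_pow, ← mul_assoc, ← mul_assoc, ← mul_assoc,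
      Algebra.commutes a S.val]

open Matrix Polynomial in
theorem gjNull_main {F : Type*} [Field F] [DecidableEq (Polynomial F)] (N : ℕ) (M : Matrix (Fin N) (Fin N) F)
    (p : ℕ) (g : Fin p → Polynomial F) (k : Fin p → ℕ)
    (hg : ∀ i, (g i).Monic ∧ Irreducible (g i) ∧ 1 ≤ k i)
    (e : Fin N ≃ (Σ i : Fin p, Fin (k i) × Fin ((g i).natDegree)))
    (S : (Matrix (Fin N) (Fin N) F)ˣ)
    (hS : M = S.val * (Matrix.reindex e.symm e.symm
      (Matrix.blockDiagonal' fun i => genJordanBlock (g i) (k i))) * S⁻¹.val)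
    (h : F[X]) (hh : h.Monic) (hhi : Irreducible h) (m : ℕ) :
    gjNull (aeval M (h ^ m)) = (∑ i, if g i = h then min m (k i) else 0) * h.natDegree := by
  have hrank : (aeval M (h ^ m)).rank =
      (blockDiagonal' fun i => aeval (genJordanBlock (g i) (k i)) (h ^ m)).rank := by
    rw [← gj_aeval_blockDiagonal, hS, gj_aeval_conj,
      Matrix.rank_mul_eq_left_of_isUnit_det _ _
        ((Matrix.isUnit_iff_isUnit_det _).1 S⁻¹.isUnit),
      Matrix.rank_mul_eq_right_of_isUnit_det _ _
        ((Matrix.isUnit_iff_isUnit_det _).1 S.isUnit)]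
    have := Polynomial.aeval_algHom_apply (Matrix.reindexAlgEquiv F F e.symm)
      (blockDiagonal' fun i => genJordanBlock (g i) (k i)) (h ^ m)
    rw [Matrix.reindexAlgEquiv_apply, Matrix.reindexAlgEquiv_apply] at this
    rw [this, Matrix.rank_reindex]
  have h1 := gjNull_add_rank (aeval M (h ^ m))
  have h2 := gjNull_add_rank
    (blockDiagonal' fun i => aeval (genJordanBlock (g i) (k i)) (h ^ m))
  have h3 := Fintype.card_congr e
  have h4 : gjNull (aeval M (h ^ m)) =
      gjNull (blockDiagonal' fun i => aeval (genJordanBlock (g i) (k i)) (h ^ m)) := by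
    omega
  rw [h4, gjNull_blockDiagonal, Finset.sum_mul]
  apply Finset.sum_congr rfl
  intro i _
  split_ifs with hi
  · rw [← hi, gjNull_block_same _ (hg i).1]
  · rw [gjNull_block_ne _ _ (hg i).1 (hg i).2.1 hh hhi hi, zero_mul]

theorem gj_count {α : Type*} [DecidableEq α] (p : ℕ) (g : Fin p → α) (k : Fin p → ℕ) (h : α)
    (m : ℕ) :
    Multiset.count (h, m + 1) (Multiset.map (fun i => (g i, k i)) Finset.univ.val)
      + (∑ i, if g i = h then min m (k i) else 0)
      + (∑ i, if g i = h then min (m + 2) (k i) else 0)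
      = 2 * ∑ i, if g i = h then min (m + 1) (k i) else 0 := by
  have hc : Multiset.count (h, m + 1) (Multiset.map (fun i => (g i, k i)) Finset.univ.val)
      = ∑ i, if g i = h ∧ k i = m + 1 then 1 else 0 := by
    rw [Multiset.count_map, ← Finset.card_filter, ← Finset.filter_val, Finset.card_val]
    congr 1
    ext i
    simp [Prod.ext_iff, eq_comm]
  rw [hc, Finset.mul_sum, ← Finset.sum_add_distrib, ← Finset.sum_add_distrib]
  apply Finset.sum_congr rfl
  intro i _
  by_cases hi : g i = h
  · simp only [hi, true_and, if_true]
    split_ifs <;> omega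
  · simp [hi]

/-- Uniqueness of the generalized Jordan normal form: if a matrix is similar to two
block-diagonal matrices in generalized Jordan form, the collections of blocks
(recorded as the multiset of pairs (irreducible polynomial, number of companion copies))
coincide. -/
theorem stmt9 {F : Type*} [Field F] (N : ℕ) (M : Matrix (Fin N) (Fin N) F)
    (p q : ℕ) (g : Fin p → Polynomial F) (k : Fin p → ℕ)
    (g' : Fin q → Polynomial F) (k' : Fin q → ℕ)
    (hg : ∀ i, (g i).Monic ∧ Irreducible (g i) ∧ 1 ≤ k i)
    (hg' : ∀ i, (g' i).Monic ∧ Irreducible (g' i) ∧ 1 ≤ k' i)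
    (e : Fin N ≃ (Σ i : Fin p, Fin (k i) × Fin ((g i).natDegree)))
    (e' : Fin N ≃ (Σ i : Fin q, Fin (k' i) × Fin ((g' i).natDegree)))
    (S S' : (Matrix (Fin N) (Fin N) F)ˣ)
    (hS : M = S.val * (Matrix.reindex e.symm e.symm
      (Matrix.blockDiagonal' fun i => genJordanBlock (g i) (k i))) * S⁻¹.val)
    (hS' : M = S'.val * (Matrix.reindex e'.symm e'.symm
      (Matrix.blockDiagonal' fun i => genJordanBlock (g' i) (k' i))) * S'⁻¹.val) :
    Multiset.map (fun i => (g i, k i)) Finset.univ.val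
      = Multiset.map (fun i => (g' i, k' i)) Finset.univ.val := by
  classical
  have key : ∀ h : Polynomial F, h.Monic → Irreducible h → ∀ m : ℕ,
      (∑ i, if g i = h then min m (k i) else 0) = ∑ i, if g' i = h then min m (k' i) else 0 := by
    intro h hh hhi m
    have h1 := gjNull_main N M p g k hg e S hS h hh hhi m
    have h2 := gjNull_main N M q g' k' hg' e' S' hS' h hh hhi m
    exact Nat.eq_of_mul_eq_mul_right hhi.natDegree_pos (h1.symm.trans h2)
  ext ⟨h, m⟩
  by_cases hh : h.Monic ∧ Irreducible h ∧ 1 ≤ m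
  · obtain ⟨hh, hhi, hm⟩ := hh
    obtain ⟨n, rfl⟩ : ∃ n, m = n + 1 := ⟨m - 1, by omega⟩
    have c1 := gj_count p g k h n
    have c2 := gj_count q g' k' h n
    rw [key h hh hhi n, key h hh hhi (n + 1), key h hh hhi (n + 2)] at c1
    omega
  · rw [Multiset.count_eq_zero_of_notMem, Multiset.count_eq_zero_of_notMem]
    · intro hmem
      obtain ⟨i, -, hi⟩ := Multiset.mem_map.1 hmem
      obtain ⟨rfl, rfl⟩ := Prod.mk.inj hi
      exact hh (hg' i)
    · intro hmem
      obtain ⟨i, -, hi⟩ := Multiset.mem_map.1 hmem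
      obtain ⟨rfl, rfl⟩ := Prod.mk.inj hi
      exact hh (hg i)
end
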